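/- Let K be the field with 2 elements and let L be a field extension of K with 16 elements. Then the tensor rank of the Gabidulin code G = {x ↦ a·x + b·x^2 : a, b ∈ L} equals 12; that is, 12 is the least natural number R for which there exist R rank-one K-linear maps f_1, …, f_R : L → L such that G is contained in the K-linear span of {f_1, …, f_R}. -/

import Mathlib

section GabidulinCode

variable {K L : Type*} [Field K] [Field L] [Algebra K L]

/-- The rank-one map `x ↦ Tr(α x) β`. -/
noncomputable def traceRankOne (K : Type*) {L : Type*} [Field K] [Field L] [Algebra K L]
    (α β : L) : L →ₗ[K] L :=
  ((Algebra.trace K L) ∘ₗ LinearMap.mulLeft K α).smulRight β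

theorem finrank_range_traceRankOne [FiniteDimensional K L] [Algebra.IsSeparable K L]
    {α β : L} (hα : α ≠ 0) (hβ : β ≠ 0) :
    Module.finrank K (LinearMap.range (traceRankOne K α β)) = 1 := by
  have hs : Function.Surjective ((Algebra.trace K L) ∘ₗ LinearMap.mulLeft K α) :=
    (Algebra.trace_surjective K L).comp (mul_left_surjective₀ hα)
  rw [traceRankOne, LinearMap.range_smulRight_apply_of_surjective hs, finrank_span_singleton hβ]

theorem finrank_eq_four [Fintype K] [Fintype L]
    (hK : Fintype.card K = 2) (hL : Fintype.card L = 16) : Module.finrank K L = 4 := by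
  have h := Module.card_eq_pow_finrank (K := K) (V := L)
  rw [hK, hL] at h
  exact (Nat.pow_right_injective le_rfl (h.symm.trans (by norm_num : 16 = 2 ^ 4)))

theorem traceRankOne_apply [Fintype K] [Fintype L]
    (hK : Fintype.card K = 2) (hL : Fintype.card L = 16) (α β x : L) :
    traceRankOne K α β x =
      β * (α * x + α ^ 2 * x ^ 2 + α ^ 4 * x ^ 4 + α ^ 8 * x ^ 8) := by
  have h := FiniteField.algebraMap_trace_eq_sum_pow K L (α * x)
  simp only [Nat.card_eq_fintype_card, hK, finrank_eq_four hK hL, Finset.sum_range_succ,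
    Finset.sum_range_zero] at h
  simp only [traceRankOne, LinearMap.smulRight_apply, LinearMap.comp_apply,
    LinearMap.mulLeft_apply, Algebra.smul_def, h]
  ring

/-- The linear parametrization of the Gabidulin code: `(a, b)` is sent to
`x ↦ a x + b x ^ q`, where `q` is the cardinality of `K`. -/
noncomputable def gabidulinMap (K L : Type*) [Field K] [Field L] [Algebra K L] [Fintype K] :
    L × L →ₗ[K] (L →ₗ[K] L) :=
  (LinearMap.mul K L).coprod
    (LinearMap.lcomp K L (FiniteField.frobeniusAlgHom K L).toLinearMap ∘ₗ LinearMap.mul K L)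

theorem gabidulinMap_apply [Fintype K] (hK : Fintype.card K = 2) (p : L × L) (x : L) :
    gabidulinMap K L p x = p.1 * x + p.2 * x ^ 2 := by
  simp [gabidulinMap, hK]

theorem finrank_ker_gabidulinMap_le_one [Fintype K] [Fintype L] (hK : Fintype.card K = 2)
    {p : L × L} (hp : p ≠ 0) :
    Module.finrank K (LinearMap.ker (gabidulinMap K L p)) ≤ 1 := by
  classical
  have hsub : ((LinearMap.ker (gabidulinMap K L p) : Submodule K L) : Set L) ⊆
      {0, -p.1 / p.2} := by
    intro x hx
    have hx' : x * (p.1 + p.2 * x) = 0 := by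
      have := LinearMap.mem_ker.1 hx
      rw [gabidulinMap_apply hK] at this
      linear_combination this
    rcases mul_eq_zero.1 hx' with h | h
    · exact Or.inl h
    · right
      have h2 : p.2 ≠ 0 := by
        intro h2
        apply hp
        rw [h2, zero_mul, add_zero] at h
        exact Prod.ext h h2
      rw [Set.mem_singleton_iff, eq_div_iff h2]
      linear_combination h
  have hcard : Nat.card (LinearMap.ker (gabidulinMap K L p)) ≤ 2 :=
    (Set.ncard_le_ncard hsub).trans ((Set.ncard_insert_le _ _).trans (by simp))
  rw [Module.natCard_eq_pow_finrank (K := K), Nat.card_eq_fintype_card, hK] at hcard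
  exact (Nat.pow_le_pow_iff_right one_lt_two).1 (by simpa using hcard)

theorem finrank_range_sub_le {V W : Type*} [AddCommGroup V] [Module K V] [AddCommGroup W]
    [Module K W] [FiniteDimensional K W] (f g : V →ₗ[K] W) :
    Module.finrank K (LinearMap.range (f - g)) ≤
      Module.finrank K (LinearMap.range f) + Module.finrank K (LinearMap.range g) := by
  refine (Submodule.finrank_mono ?_).trans (Submodule.finrank_add_le_finrank_add_finrank _ _)
  rintro _ ⟨x, rfl⟩
  exact Submodule.sub_mem_sup ⟨x, rfl⟩ ⟨x, rfl⟩

/-- Distinct maps of rank at most one lie in distinct cosets of the Gabidulin code. -/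
theorem gabidulinMap_add_injective [Fintype K] [Fintype L]
    (hK : Fintype.card K = 2) (hL : Fintype.card L = 16) {S : Set (L →ₗ[K] L)}
    (hS : ∀ s ∈ S, Module.finrank K (LinearMap.range s) ≤ 1) :
    Function.Injective fun z : (L × L) × S ↦ gabidulinMap K L z.1 + (z.2 : L →ₗ[K] L) := by
  rintro ⟨p, s, hs⟩ ⟨q, t, ht⟩ h
  have hsub : gabidulinMap K L (p - q) = t - s := by
    rw [map_sub]
    simp only at h
    rw [sub_eq_sub_iff_add_eq_add, h, add_comm]
  have hpq : p - q = 0 := by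
    by_contra hne
    have h1 := finrank_ker_gabidulinMap_le_one hK hne
    have h2 := LinearMap.finrank_range_add_finrank_ker (gabidulinMap K L (p - q))
    have h3 := finrank_range_sub_le t s
    rw [← hsub] at h3
    have h4 := hS s hs
    have h5 := hS t ht
    have h6 := finrank_eq_four hK hL
    omega
  rw [hpq, map_zero] at hsub
  have hst : s = t := (sub_eq_zero.1 hsub.symm).symm
  subst hst
  rw [sub_eq_zero.1 hpq]

theorem twelve_le_of_gabidulinMap_mem_span [Fintype K] [Fintype L]
    (hK : Fintype.card K = 2) (hL : Fintype.card L = 16) {R : ℕ} (f : Fin R → (L →ₗ[K] L))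
    (hf : ∀ i, Module.finrank K (LinearMap.range (f i)) = 1)
    (hG : ∀ p, gabidulinMap K L p ∈ Submodule.span K (Set.range f)) : 12 ≤ R := by
  classical
  have : Finite (L →ₗ[K] L) := Finite.of_injective _ DFunLike.coe_injective
  have h0 : (0 : L →ₗ[K] L) ∉ Set.range f := by
    rintro ⟨i, hi⟩
    have := hf i
    rw [hi, LinearMap.range_zero, finrank_bot] at this
    exact zero_ne_one this
  set S : Set (L →ₗ[K] L) := insert 0 (Set.range f) with hSdef
  have hS : ∀ s ∈ S, Module.finrank K (LinearMap.range s) ≤ 1 := by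
    rintro s (rfl | ⟨i, rfl⟩)
    · rw [LinearMap.range_zero, finrank_bot]
      exact zero_le_one
    · exact (hf i).le
  have hSV : S ⊆ Submodule.span K (Set.range f) :=
    Set.insert_subset (zero_mem _) Submodule.subset_span
  have hinj : Function.Injective fun z : (L × L) × S ↦
      (⟨gabidulinMap K L z.1 + (z.2 : L →ₗ[K] L), add_mem (hG _) (hSV z.2.2)⟩ :
        Submodule.span K (Set.range f)) := fun z w h ↦
    gabidulinMap_add_injective hK hL hS (congrArg Subtype.val h)
  have hcard := Nat.card_le_card_of_injective _ hinj
  rw [Module.natCard_eq_pow_finrank (K := K) (V := Submodule.span K (Set.range f)),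
    Nat.card_prod, Nat.card_prod,
    Nat.card_eq_fintype_card (α := K), Nat.card_eq_fintype_card (α := L), hK, hL,
    Nat.card_coe_set_eq, hSdef, Set.ncard_insert_of_notMem h0] at hcard
  have hr : Module.finrank K (Submodule.span K (Set.range f)) ≤ (Set.range f).ncard := by
    rw [Set.ncard_eq_toFinset_card']
    exact finrank_span_le_card _
  have hR : Module.finrank K (Submodule.span K (Set.range f)) ≤ R :=
    (finrank_range_le_card (R := K) f).trans_eq (Fintype.card_fin R)
  by_contra! hlt
  generalize Module.finrank K (Submodule.span K (Set.range f)) = r at *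
  have : r < 12 := hR.trans_lt hlt
  interval_cases r <;> omega

/-- A field with 16 elements has a generator of its multiplicative group that is a root of
`X ^ 4 + X + 1`. -/
theorem exists_primitive_root_of_card_eq_sixteen [Fintype L] [CharP L 2]
    (hL : Fintype.card L = 16) :
    ∃ t : L, t ^ 4 = t + 1 ∧ ∀ a : L, a ≠ 0 → ∃ k : ℕ, a = t ^ k := by
  classical
  obtain ⟨g, hg⟩ := IsCyclic.exists_generator (α := Lˣ)
  have h2 : (2 : L) = 0 := CharTwo.two_eq_zero
  have hord : orderOf g = 15 := by
    rw [orderOf_eq_card_of_forall_mem_zpowers hg, Nat.card_eq_fintype_card,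
      Fintype.card_units, hL]
  have hpow (n : ℕ) (hn : ¬ 15 ∣ n) : (g : L) ^ n - 1 ≠ 0 := by
    rw [← hord, orderOf_dvd_iff_pow_eq_one] at hn
    intro h
    apply hn
    ext
    push_cast
    exact sub_eq_zero.1 h
  have h15 : (g : L) ^ 15 = 1 := by
    rw [← Units.val_pow_eq_pow_val, ← hord, pow_orderOf_eq_one, Units.val_one]
  have hgen (u : Lˣ) (hu : ∀ x, x ∈ Subgroup.zpowers u) (a : L) (ha : a ≠ 0) :
      ∃ k : ℕ, a = (u : L) ^ k := by
    obtain ⟨k, hk⟩ := (mem_powers_iff_mem_zpowers).2 (hu (Units.mk0 a ha))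
    refine ⟨k, ?_⟩
    rw [← Units.val_pow_eq_pow_val]
    exact (congrArg Units.val hk).symm
  have h3 := hpow 3 (by norm_num)
  have h5 := hpow 5 (by norm_num)
  generalize hx : (g : L) = x at *
  have hprod : (x ^ 5 - 1) * ((x ^ 3 - 1) * ((x ^ 4 + x + 1) * (x ^ 4 + x ^ 3 + 1))) = 0 := by
    have hx15 : (x - 1) * (x ^ 15 - 1) = 0 := by rw [h15]; ring
    linear_combination hx15 +
      (x + x ^ 4 - x ^ 6 - x ^ 7 - x ^ 9 - x ^ 10 + x ^ 12 + x ^ 15) * h2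
  have hroots := (mul_eq_zero.1 ((mul_eq_zero.1 hprod).resolve_left h5)).resolve_left h3
  rcases mul_eq_zero.1 hroots with h | h
  · exact ⟨x, by linear_combination h - (x + 1) * h2, fun a ha ↦ hx ▸ hgen g hg a ha⟩
  · refine ⟨(g⁻¹ : Lˣ), ?_, hgen g⁻¹ (by simpa using hg)⟩
    have hx0 : x ≠ 0 := hx ▸ g.ne_zero
    rw [Units.val_inv_eq_inv_val, hx]
    field_simp
    linear_combination h - (x ^ 3 + x ^ 4) * h2

/-- Exponents `i` such that the maps `x ↦ Tr(t ^ i x) t ^ j` span the Gabidulin code,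
where `j` is the corresponding entry of `valueExponent`. -/
def traceExponent : Fin 12 → ℕ := ![2, 12, 13, 8, 14, 0, 6, 7, 0, 4, 9, 3]

/-- The exponents of the values paired with `traceExponent`. -/
def valueExponent : Fin 12 → ℕ := ![8, 5, 3, 12, 11, 6, 2, 3, 10, 13, 0, 14]

/-- Twelve rank-one maps spanning a space that contains the Gabidulin code when
`t ^ 4 = t + 1`. -/
noncomputable def rankOneFamily (K : Type*) {L : Type*} [Field K] [Field L] [Algebra K L]
    (t : L) (i : Fin 12) : L →ₗ[K] L :=
  traceRankOne K (t ^ traceExponent i) (t ^ valueExponent i)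

theorem gabidulinMap_mem_span_rankOneFamily_of_sum [Fintype K] [Fintype L]
    (hK : Fintype.card K = 2) (hL : Fintype.card L = 16) {t : L} (ht : t ^ 15 = 1)
    (s : Finset (Fin 12)) (p : L × L)
    (h1 : ∑ i ∈ s, t ^ ((valueExponent i + traceExponent i) % 15) = p.1)
    (h2 : ∑ i ∈ s, t ^ ((valueExponent i + 2 * traceExponent i) % 15) = p.2)
    (h4 : ∑ i ∈ s, t ^ ((valueExponent i + 4 * traceExponent i) % 15) = 0)
    (h8 : ∑ i ∈ s, t ^ ((valueExponent i + 8 * traceExponent i) % 15) = 0) :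
    gabidulinMap K L p ∈ Submodule.span K (Set.range (rankOneFamily K t)) := by
  have hmod (n : ℕ) : t ^ (n % 15) = t ^ n := (pow_eq_pow_mod n ht).symm
  simp only [hmod] at h1 h2 h4 h8
  have hsum : gabidulinMap K L p = ∑ i ∈ s, rankOneFamily K t i := by
    ext x
    rw [gabidulinMap_apply hK, LinearMap.sum_apply]
    simp only [rankOneFamily, traceRankOne_apply hK hL]
    calc p.1 * x + p.2 * x ^ 2 = p.1 * x + p.2 * x ^ 2 + 0 * x ^ 4 + 0 * x ^ 8 := by ring
      _ = _ := by
        nth_rw 2 [← h8]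
        rw [← h1, ← h2, ← h4]
        simp only [Finset.sum_mul, ← Finset.sum_add_distrib]
        exact Finset.sum_congr rfl fun i _ ↦ by ring
  rw [hsum]
  exact sum_mem fun i _ ↦ Submodule.subset_span ⟨i, rfl⟩

theorem gabidulinMap_pow_mem_span_rankOneFamily [Fintype K] [Fintype L] [CharP L 2]
    (hK : Fintype.card K = 2) (hL : Fintype.card L = 16) {t : L} (ht : t ^ 4 = t + 1)
    (k : ℕ) :
    gabidulinMap K L (t ^ k, 0) ∈ Submodule.span K (Set.range (rankOneFamily K t)) ∧
    gabidulinMap K L (0, t ^ k) ∈ Submodule.span K (Set.range (rankOneFamily K t)) := by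
  have h2 : (2 : L) = 0 := CharTwo.two_eq_zero
  have t5 : t ^ 5 = t ^ 2 + t := by linear_combination t * ht
  have t6 : t ^ 6 = t ^ 3 + t ^ 2 := by linear_combination t * t5
  have t7 : t ^ 7 = t ^ 3 + t + 1 := by linear_combination t * t6 + ht
  have t8 : t ^ 8 = t ^ 2 + 1 := by linear_combination t * t7 + ht + t * h2
  have t9 : t ^ 9 = t ^ 3 + t := by linear_combination t * t8
  have t10 : t ^ 10 = t ^ 2 + t + 1 := by linear_combination t * t9 + ht
  have t11 : t ^ 11 = t ^ 3 + t ^ 2 + t := by linear_combination t * t10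
  have t12 : t ^ 12 = t ^ 3 + t ^ 2 + t + 1 := by linear_combination t * t11 + ht
  have t13 : t ^ 13 = t ^ 3 + t ^ 2 + 1 := by linear_combination t * t12 + ht + t * h2
  have t14 : t ^ 14 = t ^ 3 + 1 := by linear_combination t * t13 + ht + t * h2
  have t15 : t ^ 15 = 1 := by linear_combination t * t14 + ht + t * h2
  induction k using Nat.strong_induction_on with
  | _ k ih =>
    by_cases hk : k < 4
    · have hmem := gabidulinMap_mem_span_rankOneFamily_of_sum hK hL t15
      interval_cases k
      on_goal 1 => refine ⟨hmem {0, 2, 3, 5, 7, 8, 9, 10} _ ?_ ?_ ?_ ?_,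
        hmem {0, 1, 2, 3, 4, 7, 8, 9, 11} _ ?_ ?_ ?_ ?_⟩
      on_goal 9 => refine ⟨hmem {4, 6, 7, 8} _ ?_ ?_ ?_ ?_,
        hmem {0, 1, 3, 6} _ ?_ ?_ ?_ ?_⟩
      on_goal 17 => refine ⟨hmem {0, 1, 3, 4, 6, 7, 9} _ ?_ ?_ ?_ ?_,
        hmem {2, 3, 5, 6, 8, 9, 10, 11} _ ?_ ?_ ?_ ?_⟩
      on_goal 25 => refine ⟨hmem {0, 1, 4, 5} _ ?_ ?_ ?_ ?_,
        hmem {1, 4, 8, 9} _ ?_ ?_ ?_ ?_⟩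
      all_goals
        simp [traceExponent, valueExponent, t5, t6, t7, t8, t9, t10, t11, t12, t13, t14]
        ring_nf
        reduce_mod_char!
    · obtain ⟨m, rfl⟩ := Nat.exists_eq_add_of_le (not_lt.1 hk)
      have ha : ((t ^ (4 + m), 0) : L × L) = (t ^ (m + 1), 0) + (t ^ m, 0) := by
        rw [Prod.mk_add_mk, pow_add, ht, add_zero]
        congr 1
        ring
      have hb : ((0, t ^ (4 + m)) : L × L) = (0, t ^ (m + 1)) + (0, t ^ m) := by
        rw [Prod.mk_add_mk, pow_add, ht, add_zero]
        congr 1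
        ring
      have ih0 := ih m (by omega)
      have ih1 := ih (m + 1) (by omega)
      rw [ha, hb, map_add, map_add]
      exact ⟨add_mem ih1.1 ih0.1, add_mem ih1.2 ih0.2⟩

theorem gabidulinMap_mem_span_rankOneFamily [Fintype K] [Fintype L] [CharP L 2]
    (hK : Fintype.card K = 2) (hL : Fintype.card L = 16) {t : L} (ht : t ^ 4 = t + 1)
    (hgen : ∀ a : L, a ≠ 0 → ∃ k : ℕ, a = t ^ k) (p : L × L) :
    gabidulinMap K L p ∈ Submodule.span K (Set.range (rankOneFamily K t)) := by
  obtain ⟨a, b⟩ := p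
  have hab : ((a, b) : L × L) = (a, 0) + (0, b) := by simp
  rw [hab, map_add]
  refine add_mem ?_ ?_
  · rcases eq_or_ne a 0 with rfl | ha
    · rw [← Prod.zero_eq_mk, map_zero]
      exact zero_mem _
    · obtain ⟨k, rfl⟩ := hgen a ha
      exact (gabidulinMap_pow_mem_span_rankOneFamily hK hL ht k).1
  · rcases eq_or_ne b 0 with rfl | hb
    · rw [← Prod.zero_eq_mk, map_zero]
      exact zero_mem _
    · obtain ⟨k, rfl⟩ := hgen b hb
      exact (gabidulinMap_pow_mem_span_rankOneFamily hK hL ht k).2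

end GabidulinCode

theorem stmt_1 (K L : Type*) [Field K] [Field L] [Algebra K L]
    [Fintype K] [Fintype L]
    (hK : Fintype.card K = 2) (hL : Fintype.card L = 16) :
    IsLeast {R : ℕ | ∃ f : Fin R → (L →ₗ[K] L),
      (∀ i, Module.finrank K (LinearMap.range (f i)) = 1) ∧
      ∀ g : L →ₗ[K] L, (∃ a b : L, ∀ x : L, g x = a * x + b * x ^ 2) →
        g ∈ Submodule.span K (Set.range f)} 12 := by
  constructor
  · have : CharP K 2 := charP_of_card_eq_prime hK
    have : CharP L 2 := charP_of_injective_algebraMap (algebraMap K L).injective 2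
    obtain ⟨t, ht, hgen⟩ := exists_primitive_root_of_card_eq_sixteen hL
    have ht0 : t ≠ 0 := by
      rintro rfl
      simp at ht
    refine ⟨rankOneFamily K t, fun i ↦
      finrank_range_traceRankOne (pow_ne_zero _ ht0) (pow_ne_zero _ ht0), ?_⟩
    rintro g ⟨a, b, hg⟩
    have hgab : g = gabidulinMap K L (a, b) := by
      ext x
      rw [hg, gabidulinMap_apply hK]
    rw [hgab]
    exact gabidulinMap_mem_span_rankOneFamily hK hL ht hgen (a, b)
  · rintro R ⟨f, hf, hG⟩
    exact twelve_le_of_gabidulinMap_mem_span hK hL f hf fun p ↦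
      hG _ ⟨p.1, p.2, gabidulinMap_apply hK p⟩
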